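/- arXiv:2508.06940 — 3 statements merged into one kernel-verified Lean document; each statement's English description precedes it below -/
import Mathlib

section
/- Let q ∈ [2,∞) be real, ρ ∈ (0,1), and set λ := ln( μ*·(1+ρ·(1/μ*−1))^q + (1−μ*)·(1−ρ)^q ) / ((q−1)·ln(1/μ*)). Then for every nonnegative function f : Ω → ℝ it holds that ‖T_ρ f‖_q ≤ ‖f‖_1^{1−λ} · ‖f‖_q^{λ}. -/
open Finset

/-- Expectation of `f` under the probability mass function `μ` on a finite set. -/
noncomputable def expct {Ω : Type*} [Fintype Ω] (μ : Ω → ℝ) (f : Ω → ℝ) : ℝ :=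
  ∑ x, μ x * f x

/-- The noise operator `T_ρ f = ρ f + (1-ρ) E[f]`. -/
noncomputable def noiseOp {Ω : Type*} [Fintype Ω] (μ : Ω → ℝ) (ρ : ℝ) (f : Ω → ℝ) : Ω → ℝ :=
  fun x => ρ * f x + (1 - ρ) * expct μ f

/-- The `q`-norm `(E_{x∼μ} |f(x)|^q)^{1/q}`. -/
noncomputable def qNorm {Ω : Type*} [Fintype Ω] (μ : Ω → ℝ) (q : ℝ) (f : Ω → ℝ) : ℝ :=
  (∑ x, μ x * |f x| ^ q) ^ (1 / q)

/-- Minkowski's inequality for a constant plus a function, with respect to finite weights. -/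
theorem sum_mul_const_add_rpow_le {ι : Type*} [Fintype ι] (w g : ι → ℝ) (hw : ∀ i, 0 ≤ w i)
    (hw1 : ∑ i, w i = 1) (hg : ∀ i, 0 ≤ g i) {p c d : ℝ} (hp : 1 ≤ p) (hc : 0 ≤ c) (hd : 0 ≤ d) :
    ∑ i, w i * (c + d * g i) ^ p ≤ (c + d * (∑ i, w i * g i ^ p) ^ (1 / p)) ^ p := by
  have hp0 : p ≠ 0 := by linarith
  have hroot (i : ι) : (w i ^ (1 / p)) ^ p = w i := by
    rw [← Real.rpow_mul (hw i), one_div_mul_cancel hp0, Real.rpow_one]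
  have hr0 (i : ι) : 0 ≤ w i ^ (1 / p) := Real.rpow_nonneg (hw i) _
  have key := Real.Lp_add_le_of_nonneg (s := Finset.univ) (f := fun i => w i ^ (1 / p) * c)
    (g := fun i => w i ^ (1 / p) * (d * g i)) hp (fun i _ => mul_nonneg (hr0 i) hc)
    (fun i _ => mul_nonneg (hr0 i) (mul_nonneg hd (hg i)))
  have e1 : ∑ i, (w i ^ (1 / p) * c + w i ^ (1 / p) * (d * g i)) ^ p
      = ∑ i, w i * (c + d * g i) ^ p := by
    refine Finset.sum_congr rfl fun i _ => ?_
    rw [← mul_add, Real.mul_rpow (hr0 i) (add_nonneg hc (mul_nonneg hd (hg i))), hroot]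
  have e2 : ∑ i, (w i ^ (1 / p) * c) ^ p = c ^ p := by
    simp_rw [fun i => Real.mul_rpow (z := p) (hr0 i) hc, hroot, ← Finset.sum_mul, hw1, one_mul]
  have e3 : ∑ i, (w i ^ (1 / p) * (d * g i)) ^ p = d ^ p * ∑ i, w i * g i ^ p := by
    rw [Finset.mul_sum]
    refine Finset.sum_congr rfl fun i _ => ?_
    rw [Real.mul_rpow (hr0 i) (mul_nonneg hd (hg i)), hroot, Real.mul_rpow hd (hg i)]
    ring
  have hS : 0 ≤ ∑ i, w i * g i ^ p :=
    Finset.sum_nonneg fun i _ => mul_nonneg (hw i) (Real.rpow_nonneg (hg i) _)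
  have hL : 0 ≤ ∑ i, w i * (c + d * g i) ^ p :=
    Finset.sum_nonneg fun i _ => mul_nonneg (hw i)
      (Real.rpow_nonneg (add_nonneg hc (mul_nonneg hd (hg i))) _)
  rw [e1, e2, e3, Real.mul_rpow (Real.rpow_nonneg hd _) hS, ← Real.rpow_mul hc, ← Real.rpow_mul hd,
    mul_one_div_cancel hp0, Real.rpow_one, Real.rpow_one] at key
  calc ∑ i, w i * (c + d * g i) ^ p
      = ((∑ i, w i * (c + d * g i) ^ p) ^ (1 / p)) ^ p := by
        rw [← Real.rpow_mul hL, one_div_mul_cancel hp0, Real.rpow_one]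
    _ ≤ _ := Real.rpow_le_rpow (Real.rpow_nonneg hL _) key (by linarith)

/-- The map `s ↦ log (u + v * exp s)` is convex, in multiplicative form. -/
theorem add_mul_rpow_le_rpow_mul_rpow {u v M θ : ℝ} (hu : 0 < u) (hv : 0 ≤ v) (hM : 0 ≤ M)
    (h0 : 0 ≤ θ) (h1 : θ ≤ 1) :
    u + v * M ^ θ ≤ (u + v) ^ (1 - θ) * (u + v * M) ^ θ := by
  have hs : 0 < u + v := by linarith
  have key := (Real.concaveOn_rpow h0 h1).2 (Set.mem_Ici.2 zero_le_one) (Set.mem_Ici.2 hM)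
    (div_nonneg hu.le hs.le) (div_nonneg hv hs.le)
    (show u / (u + v) + v / (u + v) = 1 by field_simp)
  simp only [smul_eq_mul, Real.one_rpow, mul_one] at key
  have e : u / (u + v) + v / (u + v) * M = (u + v * M) / (u + v) := by field_simp
  rw [e, Real.div_rpow (by positivity) hs.le] at key
  have hpos : 0 < (u + v) ^ θ := Real.rpow_pos_of_pos hs _
  calc u + v * M ^ θ = (u + v) * (u / (u + v) + v / (u + v) * M ^ θ) := by field_simp
    _ ≤ (u + v) * ((u + v * M) ^ θ / (u + v) ^ θ) := by gcongr
    _ = _ := by rw [Real.rpow_sub hs, Real.rpow_one]; ring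

/-- Weighted Young inequality applied to the log-convex map `s ↦ (u + v * exp s) ^ p`. -/
theorem rpow_neg_mul_add_mul_rpow_le {u v M θ K p : ℝ} (hu : 0 < u) (hv : 0 ≤ v) (hM : 0 ≤ M)
    (h0 : 0 ≤ θ) (h1 : θ ≤ 1) (hK : 0 < K) (hp : 0 ≤ p) :
    K ^ (-θ) * (u + v * M ^ θ) ^ p ≤ (1 - θ) * (u + v) ^ p + θ / K * (u + v * M) ^ p := by
  have hX : 0 ≤ u + v := by positivity
  have hY : 0 ≤ u + v * M := by positivity
  have hMθ : 0 ≤ u + v * M ^ θ := by positivity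
  have h := Real.rpow_le_rpow hMθ (add_mul_rpow_le_rpow_mul_rpow hu hv hM h0 h1) hp
  rw [Real.mul_rpow (by positivity) (by positivity), ← Real.rpow_mul hX, ← Real.rpow_mul hY,
    mul_comm (1 - θ) p, mul_comm θ p, Real.rpow_mul hX, Real.rpow_mul hY] at h
  have y := Real.geom_mean_le_arith_mean2_weighted (w₁ := 1 - θ) (w₂ := θ) (p₁ := (u + v) ^ p)
    (p₂ := (u + v * M) ^ p / K) (by linarith) h0 (by positivity) (by positivity) (by ring)
  rw [Real.div_rpow (by positivity) hK.le] at y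
  calc K ^ (-θ) * (u + v * M ^ θ) ^ p
      ≤ K ^ (-θ) * (((u + v) ^ p) ^ (1 - θ) * ((u + v * M) ^ p) ^ θ) := by gcongr
    _ = ((u + v) ^ p) ^ (1 - θ) * (((u + v * M) ^ p) ^ θ / K ^ θ) := by
        rw [Real.rpow_neg hK.le]; ring
    _ ≤ _ := y
    _ = _ := by ring

theorem hasDerivAt_const_add_mul_rpow {q : ℝ} (hq : 1 ≤ q) (u c t : ℝ) :
    HasDerivAt (fun t => (u + c * t) ^ q) (c * q * (u + c * t) ^ (q - 1)) t := by
  have h : HasDerivAt (fun t => u + c * t) c t := by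
    simpa using ((hasDerivAt_id t).const_mul c).const_add u
  exact h.rpow_const (Or.inr hq)

/-- Moment comparison for a nonnegative function of mean one, with `M ^ θ` playing the role of
the `(q - 1)`-norm with respect to the size-biased measure. -/
theorem sum_mul_noise_rpow_le {ι : Type*} [Fintype ι] (μ f : ι → ℝ) (hμ : ∀ i, 0 ≤ μ i)
    (hμ1 : ∑ i, μ i = 1) (hf : ∀ i, 0 ≤ f i) (hf1 : ∑ i, μ i * f i = 1)
    {q ρ M θ K : ℝ} (hq : 2 ≤ q) (hρ0 : 0 < ρ) (hρ1 : ρ < 1) (hM : 1 < M)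
    (h0 : 0 ≤ θ) (h1 : θ ≤ 1) (hθ : (∑ i, μ i * f i ^ q) ^ (1 / (q - 1)) = M ^ θ)
    (hK : K = 1 / M * (1 - ρ + ρ * M) ^ q + (1 - 1 / M) * (1 - ρ) ^ q) :
    ∑ i, μ i * (1 - ρ + ρ * f i) ^ q ≤ K ^ θ := by
  have hu : 0 < 1 - ρ := by linarith
  have hM0 : 0 < M := by linarith
  have hMinv : 1 / M < 1 := by rw [div_lt_one hM0]; exact hM
  have hK0 : 0 < K := by
    have : 0 < 1 - 1 / M := by linarith
    rw [hK]; positivity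
  have hKθ : 0 < K ^ (-θ) := Real.rpow_pos_of_pos hK0 _
  have hsize (i : ι) : μ i * f i ^ q = μ i * f i * f i ^ (q - 1) := by
    rcases (hf i).eq_or_lt with h | h
    · rw [← h, Real.zero_rpow (by linarith)]; ring
    · rw [Real.rpow_sub h, Real.rpow_one]; field_simp
  set F : ℝ → ℝ := fun t => (1 - θ) * (1 - ρ + ρ * t) ^ q
    + θ / (K * M) * (1 - ρ + ρ * M * t) ^ q
    - K ^ (-θ) * ∑ i, μ i * (1 - ρ + ρ * f i * t) ^ q with hF
  have hder (t : ℝ) : HasDerivAt F ((1 - θ) * (ρ * q * (1 - ρ + ρ * t) ^ (q - 1))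
      + θ / (K * M) * (ρ * M * q * (1 - ρ + ρ * M * t) ^ (q - 1))
      - K ^ (-θ) * ∑ i, μ i * (ρ * f i * q * (1 - ρ + ρ * f i * t) ^ (q - 1))) t := by
    have hq1 : 1 ≤ q := by linarith
    refine (((hasDerivAt_const_add_mul_rpow hq1 _ _ t).const_mul _).add
      ((hasDerivAt_const_add_mul_rpow hq1 _ _ t).const_mul _)).sub (HasDerivAt.const_mul _ ?_)
    exact HasDerivAt.fun_sum fun i _ => (hasDerivAt_const_add_mul_rpow hq1 _ _ t).const_mul _
  have hmono : MonotoneOn F (Set.Icc 0 1) := by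
    refine monotoneOn_of_deriv_nonneg (convex_Icc 0 1)
      (fun t _ => (hder t).continuousAt.continuousWithinAt)
      (fun t _ => (hder t).differentiableAt.differentiableWithinAt) fun t ht => ?_
    rw [interior_Icc] at ht
    rw [(hder t).deriv]
    have hρt : 0 ≤ ρ * t := mul_nonneg hρ0.le ht.1.le
    have mink := sum_mul_const_add_rpow_le (fun i => μ i * f i) f
      (fun i => mul_nonneg (hμ i) (hf i)) hf1 hf (p := q - 1) (by linarith) hu.le hρt
    simp only [← hsize, hθ] at mink
    have young := rpow_neg_mul_add_mul_rpow_le (p := q - 1) hu hρt hM0.le h0 h1 hK0 (by linarith)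
    have hsum : ∑ i, μ i * (ρ * f i * q * (1 - ρ + ρ * f i * t) ^ (q - 1))
        = ρ * q * ∑ i, μ i * f i * (1 - ρ + ρ * t * f i) ^ (q - 1) := by
      rw [Finset.mul_sum]
      refine Finset.sum_congr rfl fun i _ => ?_
      rw [mul_right_comm ρ (f i) t]; ring
    have hM' : θ / (K * M) * (ρ * M * q * (1 - ρ + ρ * M * t) ^ (q - 1))
        = ρ * q * (θ / K * (1 - ρ + ρ * t * M) ^ (q - 1)) := by
      rw [mul_right_comm ρ M t]; field_simp
    rw [hsum, hM']
    have hfin := (mul_le_mul_of_nonneg_left mink hKθ.le).trans young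
    have hρq : 0 ≤ ρ * q := by positivity
    nlinarith [mul_le_mul_of_nonneg_left hfin hρq]
  have h01 := hmono (Set.left_mem_Icc.2 zero_le_one) (Set.right_mem_Icc.2 zero_le_one) zero_le_one
  simp only [hF, mul_zero, add_zero, mul_one, ← Finset.sum_mul, hμ1, one_mul, sub_add_cancel,
    Real.one_rpow] at h01
  have young := Real.geom_mean_le_arith_mean2_weighted (w₁ := 1 - θ) (w₂ := θ) (p₁ := 1)
    (p₂ := 1 / K) (by linarith) h0 (by positivity) (by positivity) (by ring)
  rw [Real.one_rpow, one_mul, Real.div_rpow zero_le_one hK0.le, Real.one_rpow, one_div,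
    ← Real.rpow_neg hK0.le] at young
  have hKM : θ / (K * M) * (1 - ρ + ρ * M) ^ q - θ / (K * M) * (1 - ρ) ^ q
      = θ - θ * (1 / K) * (1 - ρ) ^ q := by
    have e : (1 - ρ + ρ * M) ^ q = M * K - (M - 1) * (1 - ρ) ^ q := by
      rw [hK]; field_simp; ring
    rw [e]; field_simp; ring
  have huq : 0 ≤ (1 - ρ) ^ q := by positivity
  have hle : K ^ (-θ) * ∑ i, μ i * (1 - ρ + ρ * f i) ^ q ≤ 1 := by
    nlinarith [mul_le_mul_of_nonneg_right young huq]
  rwa [Real.rpow_neg hK0.le, inv_mul_le_iff₀ (Real.rpow_pos_of_pos hK0 _), mul_one] at hle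

/-- The mean-one case of the norm inequality for the noise operator. -/
theorem sum_mul_noise_rpow_le_rpow_sum {ι : Type*} [Fintype ι] (μ f : ι → ℝ) (hμ : ∀ i, 0 ≤ μ i)
    (hμ1 : ∑ i, μ i = 1) (hf : ∀ i, 0 ≤ f i) (hf1 : ∑ i, μ i * f i = 1)
    {q ρ M K : ℝ} (hq : 2 ≤ q) (hρ0 : 0 < ρ) (hρ1 : ρ < 1) (hM : 1 < M) (hfM : ∀ i, f i ≤ M)
    (hK : K = 1 / M * (1 - ρ + ρ * M) ^ q + (1 - 1 / M) * (1 - ρ) ^ q) :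
    ∑ i, μ i * (1 - ρ + ρ * f i) ^ q
      ≤ (∑ i, μ i * f i ^ q) ^ (Real.log K / ((q - 1) * Real.log M)) := by
  have hu : 0 < 1 - ρ := by linarith
  have hM0 : 0 < M := by linarith
  have hp : 0 < q - 1 := by linarith
  have hlM : 0 < Real.log M := Real.log_pos hM
  have hK0 : 0 < K := by
    have : 0 < 1 - 1 / M := by
      have : 1 / M < 1 := by rw [div_lt_one hM0]; exact hM
      linarith
    rw [hK]; positivity
  have hV1 : 1 ≤ ∑ i, μ i * f i ^ q := by
    have := Real.rpow_arith_mean_le_arith_mean_rpow Finset.univ μ f (fun i _ => hμ i) hμ1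
      (fun i _ => hf i) (p := q) (by linarith)
    rwa [hf1, Real.one_rpow] at this
  have hVM : ∑ i, μ i * f i ^ q ≤ M ^ (q - 1) := by
    calc ∑ i, μ i * f i ^ q ≤ ∑ i, μ i * f i * M ^ (q - 1) := by
          refine Finset.sum_le_sum fun i _ => ?_
          rw [mul_assoc]
          refine mul_le_mul_of_nonneg_left ?_ (hμ i)
          rcases (hf i).eq_or_lt with h | h
          · rw [← h, Real.zero_rpow (by linarith)]; simp
          · calc f i ^ q = f i * f i ^ (q - 1) := by
                  rw [Real.rpow_sub h, Real.rpow_one]; field_simp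
              _ ≤ _ := by gcongr; exact hfM i
      _ = M ^ (q - 1) := by rw [← Finset.sum_mul, hf1, one_mul]
  set V := ∑ i, μ i * f i ^ q with hV
  have hV0 : 0 < V := by linarith
  have hlVM : Real.log V ≤ (q - 1) * Real.log M := by
    rw [← Real.log_rpow hM0]; exact Real.log_le_log hV0 hVM
  have key := sum_mul_noise_rpow_le μ f hμ hμ1 hf hf1 (θ := Real.log V / ((q - 1) * Real.log M))
    hq hρ0 hρ1 hM (div_nonneg (Real.log_nonneg hV1) (by positivity))
    (by rwa [div_le_one (by positivity)])
    (by
      rw [← hV, Real.rpow_def_of_pos hV0, Real.rpow_def_of_pos hM0]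
      congr 1; field_simp) hK
  refine key.trans_eq ?_
  rw [Real.rpow_def_of_pos hV0, Real.rpow_def_of_pos hK0]
  congr 1; ring

theorem stmt0 {Ω : Type*} [Fintype Ω] (hΩ : 2 ≤ Fintype.card Ω)
    (μ : Ω → ℝ) (hμpos : ∀ x, 0 < μ x) (hμsum : ∑ x, μ x = 1)
    (μs : ℝ) (hμs_le : ∀ x, μs ≤ μ x) (hμs_mem : ∃ x, μ x = μs)
    (q ρ lam : ℝ) (hq : 2 ≤ q) (hρ0 : 0 < ρ) (hρ1 : ρ < 1)
    (hlam : lam = Real.log (μs * (1 + ρ * (1 / μs - 1)) ^ q + (1 - μs) * (1 - ρ) ^ q) /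
      ((q - 1) * Real.log (1 / μs)))
    (f : Ω → ℝ) (hf : ∀ x, 0 ≤ f x) :
    qNorm μ q (noiseOp μ ρ f) ≤ qNorm μ 1 f ^ (1 - lam) * qNorm μ q f ^ lam := by
  obtain ⟨x₀, hx₀⟩ := hμs_mem
  have hμs0 : 0 < μs := hx₀ ▸ hμpos x₀
  have hμs1 : μs < 1 := by
    have : Nontrivial Ω := Fintype.one_lt_card_iff_nontrivial.1 hΩ
    obtain ⟨y, hy⟩ := exists_ne x₀
    have h := Finset.add_le_sum (f := μ) (fun i _ => (hμpos i).le) (Finset.mem_univ x₀)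
      (Finset.mem_univ y) hy.symm
    linarith [hμpos y]
  have hm0 : 0 ≤ ∑ x, μ x * f x := Finset.sum_nonneg fun x _ => mul_nonneg (hμpos x).le (hf x)
  have hq0 : q ≠ 0 := by linarith
  have hn1 : qNorm μ 1 f = ∑ x, μ x * f x := by
    simp [qNorm, abs_of_nonneg (hf _)]
  rcases hm0.eq_or_lt with hm | hm
  · have hf0 : ∀ x, f x = 0 := fun x => by
      have := (Finset.sum_eq_zero_iff_of_nonneg
        (fun x _ => mul_nonneg (hμpos x).le (hf x))).1 hm.symm x (Finset.mem_univ x)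
      exact (mul_eq_zero.1 this).resolve_left (hμpos x).ne'
    have hL : qNorm μ q (noiseOp μ ρ f) = 0 := by
      simp [qNorm, noiseOp, expct, hf0, Real.zero_rpow hq0, Real.zero_rpow (inv_ne_zero hq0)]
    have hnn (r : ℝ) : 0 ≤ qNorm μ r f := Real.rpow_nonneg
      (Finset.sum_nonneg fun x _ => mul_nonneg (hμpos x).le (Real.rpow_nonneg (abs_nonneg _) _)) _
    rw [hL]
    exact mul_nonneg (Real.rpow_nonneg (hnn 1) _) (Real.rpow_nonneg (hnn q) _)
  · set m := ∑ x, μ x * f x with hmdef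
    have hg0 : ∀ x, 0 ≤ f x / m := fun x => div_nonneg (hf x) hm.le
    have hg1 : ∑ x, μ x * (f x / m) = 1 := by
      simp_rw [← mul_div_assoc, ← Finset.sum_div]
      exact div_self hm.ne'
    have hgM (x : Ω) : f x / m ≤ 1 / μs := by
      rw [le_div_iff₀ hμs0]
      calc f x / m * μs ≤ μ x * (f x / m) := by
            rw [mul_comm]; exact mul_le_mul_of_nonneg_right (hμs_le x) (hg0 x)
        _ ≤ ∑ x, μ x * (f x / m) := Finset.single_le_sum
            (f := fun x => μ x * (f x / m))
            (fun x _ => mul_nonneg (hμpos x).le (hg0 x)) (Finset.mem_univ x)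
        _ = 1 := hg1
    have key := sum_mul_noise_rpow_le_rpow_sum μ (fun x => f x / m) (fun x => (hμpos x).le) hμsum
      hg0 hg1 (M := 1 / μs) hq hρ0 hρ1 (by rw [lt_div_iff₀ hμs0]; linarith) hgM rfl
    have hKeq : 1 / (1 / μs) * (1 - ρ + ρ * (1 / μs)) ^ q + (1 - 1 / (1 / μs)) * (1 - ρ) ^ q
        = μs * (1 + ρ * (1 / μs - 1)) ^ q + (1 - μs) * (1 - ρ) ^ q := by
      rw [one_div_one_div]; ring_nf
    rw [hKeq, ← hlam] at key
    have hρ' : 0 ≤ 1 - ρ := by linarith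
    have hscale (h : Ω → ℝ) (hh : ∀ x, 0 ≤ h x) :
        (∑ x, μ x * |m * h x| ^ q) ^ (1 / q) = m * (∑ x, μ x * h x ^ q) ^ (1 / q) := by
      have hs : ∑ x, μ x * |m * h x| ^ q = m ^ q * ∑ x, μ x * h x ^ q := by
        rw [Finset.mul_sum]
        refine Finset.sum_congr rfl fun x _ => ?_
        rw [abs_of_nonneg (mul_nonneg hm.le (hh x)), Real.mul_rpow hm.le (hh x)]; ring
      rw [hs, Real.mul_rpow (by positivity) (Finset.sum_nonneg fun x _ =>
        mul_nonneg (hμpos x).le (Real.rpow_nonneg (hh x) _)), ← Real.rpow_mul hm.le,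
        mul_one_div_cancel hq0, Real.rpow_one]
    have hg2 : ∀ x, 0 ≤ 1 - ρ + ρ * (f x / m) := fun x =>
      add_nonneg hρ' (mul_nonneg hρ0.le (hg0 x))
    have hT : qNorm μ q (noiseOp μ ρ f)
        = m * (∑ x, μ x * (1 - ρ + ρ * (f x / m)) ^ q) ^ (1 / q) := by
      rw [← hscale _ hg2]
      have (x : Ω) : noiseOp μ ρ f x = m * (1 - ρ + ρ * (f x / m)) := by
        simp only [noiseOp, expct, ← hmdef]; field_simp; ring
      simp only [qNorm, this]
    have hN : qNorm μ q f = m * (∑ x, μ x * (f x / m) ^ q) ^ (1 / q) := by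
      rw [← hscale _ hg0]
      simp only [qNorm, mul_div_cancel₀ _ hm.ne']
    have hV0 : 0 ≤ ∑ x, μ x * (f x / m) ^ q := Finset.sum_nonneg fun x _ =>
      mul_nonneg (hμpos x).le (Real.rpow_nonneg (hg0 x) _)
    have hW0 : 0 ≤ ∑ x, μ x * (1 - ρ + ρ * (f x / m)) ^ q := Finset.sum_nonneg fun x _ =>
      mul_nonneg (hμpos x).le (Real.rpow_nonneg (hg2 x) _)
    rw [hT, hN, hn1]
    calc m * (∑ x, μ x * (1 - ρ + ρ * (f x / m)) ^ q) ^ (1 / q)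
        ≤ m * ((∑ x, μ x * (f x / m) ^ q) ^ lam) ^ (1 / q) := by
          refine mul_le_mul_of_nonneg_left ?_ hm.le
          exact Real.rpow_le_rpow hW0 key (by positivity)
      _ = m ^ (1 - lam) * (m * (∑ x, μ x * (f x / m) ^ q) ^ (1 / q)) ^ lam := by
          rw [Real.mul_rpow hm.le (Real.rpow_nonneg hV0 _), ← mul_assoc, ← Real.rpow_add hm,
            sub_add_cancel, Real.rpow_one, ← Real.rpow_mul hV0, ← Real.rpow_mul hV0,
            mul_comm lam]
end

section
/- (MacWilliams identities.) Let (a_0,…,a_n) be the weight distribution of C and (b_0,…,b_n) the weight distribution of the dual code C^⊥. Then for every real α, Σ_{j=0}^n b_j·α^j = (1/|C|)·Σ_{j=0}^n a_j·(1−α)^j·(1+(k−1)α)^{n−j}. -/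
open Finset

/-- Hamming weight of a vector. -/
def wtv {F : Type*} [DecidableEq F] [Zero F] {n : ℕ} (x : Fin n → F) : ℕ :=
  (Finset.univ.filter fun i => x i ≠ 0).card

/-- `wdist C i` is the number of codewords of `C` of Hamming weight `i`. -/
noncomputable def wdist {F : Type*} [Field F] [DecidableEq F] {n : ℕ}
    (C : Submodule F (Fin n → F)) (i : ℕ) : ℕ :=
  Nat.card {x : Fin n → F // x ∈ C ∧ wtv x = i}

/-- The dual code `C^⊥ = {x : Σ_i x_i y_i = 0 for all y ∈ C}`. -/
def dualCode {F : Type*} [Field F] {n : ℕ} (C : Submodule F (Fin n → F)) :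
    Submodule F (Fin n → F) where
  carrier := {x | ∀ y ∈ C, ∑ i, x i * y i = 0}
  add_mem' := by
    intro a b ha hb y hy
    simpa [add_mul, Finset.sum_add_distrib] using by rw [ha y hy, hb y hy]; ring
  zero_mem' := by intro y hy; simp
  smul_mem' := by
    intro c a ha y hy
    simp only [Set.mem_setOf_eq] at ha ⊢
    simp [smul_eq_mul, mul_assoc, ← Finset.mul_sum, ha y hy]

section WeightEnumerator

variable {F : Type*} [Field F] [DecidableEq F] {n : ℕ}

theorem wtv_le (x : Fin n → F) : wtv x ≤ n := by
  simpa [wtv] using Finset.card_filter_le (Finset.univ : Finset (Fin n)) fun i => x i ≠ 0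

theorem prod_ite_eq_zero_eq_pow_wtv {R : Type*} [CommMonoid R] (x : Fin n → F) (a b : R) :
    ∏ i, (if x i = 0 then a else b) = b ^ wtv x * a ^ (n - wtv x) := by
  have h := Finset.card_filter_add_card_filter_not (s := (Finset.univ : Finset (Fin n)))
    (fun i => x i = 0)
  have hz : #{i | x i = 0} = n - wtv x := by
    simp only [card_univ, Fintype.card_fin] at h
    simp only [wtv, ne_eq]
    omega
  rw [Finset.prod_ite, prod_const, prod_const, hz, mul_comm]
  rfl

open Classical in
theorem sum_wdist_mul [Fintype F] {R : Type*} [CommSemiring R]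
    (C : Submodule F (Fin n → F)) (f : ℕ → R) :
    ∑ j ∈ range (n + 1), (wdist C j : R) * f j = ∑ x with x ∈ C, f (wtv x) := by
  rw [← Finset.sum_fiberwise_of_maps_to (g := wtv) (t := range (n + 1))
    fun x _ => mem_range.2 (Nat.lt_succ_of_le (wtv_le x))]
  refine sum_congr rfl fun j _ => ?_
  rw [sum_congr rfl fun x hx => congrArg f (mem_filter.1 hx).2, sum_const, nsmul_eq_mul,
    filter_filter, wdist, Nat.card_eq_fintype_card, Fintype.card_subtype]

end WeightEnumerator

section Characters

theorem addChar_map_sum {ι A R : Type*} [AddCommMonoid A] [CommMonoid R] (ψ : AddChar A R)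
    (s : Finset ι) (f : ι → A) : ψ (∑ i ∈ s, f i) = ∏ i ∈ s, ψ (f i) :=
  map_prod ψ.toMonoidHom (fun i => Multiplicative.ofAdd (f i)) s

variable {F : Type*} [Field F] [Fintype F] {n : ℕ}

open Classical in
theorem sum_addChar_code {R : Type*} [CommRing R] [IsDomain R] {ψ : AddChar F R} (hψ : ψ ≠ 1)
    (C : Submodule F (Fin n → F)) (x : Fin n → F) :
    ∑ y with y ∈ C, ψ (∑ i, x i * y i) = if x ∈ dualCode C then (Nat.card C : R) else 0 := by
  have hcard : #{y | y ∈ C} = Nat.card C := by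
    rw [Nat.card_eq_fintype_card, Fintype.card_subtype]
  split_ifs with hx
  · rw [sum_congr rfl fun y hy => by rw [hx y (mem_filter.1 hy).2, AddChar.map_zero_eq_one],
      sum_const, nsmul_one, hcard]
  · obtain ⟨y, hy, hxy⟩ : ∃ y ∈ C, ∑ i, x i * y i ≠ 0 := by
      by_contra! h
      exact hx h
    obtain ⟨a, ha⟩ := (AddChar.ne_one_iff).1 hψ
    let φ : AddChar C R := ψ.compAddMonoidHom
      ((dotProductBilin F F x).toAddMonoidHom.comp C.subtype.toAddMonoidHom)
    have hφ_apply (z : C) : φ z = ψ (∑ i, x i * z.1 i) := rfl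
    have hφ : φ ≠ 1 := AddChar.ne_one_iff.2
      ⟨⟨(a / ∑ i, x i * y i) • y, C.smul_mem _ hy⟩, by
        have hsmul : ∑ i, x i * ((a / ∑ i, x i * y i) • y) i = a := by
          simp only [Pi.smul_apply, smul_eq_mul, mul_left_comm (x _), ← mul_sum]
          exact div_mul_cancel₀ _ hxy
        rwa [hφ_apply, hsmul]⟩
    rw [Finset.sum_subtype _ (p := (· ∈ C)) (by simp)]
    exact AddChar.sum_eq_zero_of_ne_one hφ

variable [DecidableEq F]

theorem sum_ite_mul_addChar {R : Type*} [CommRing R] [IsDomain R] {ψ : AddChar F R}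
    (hψ : ψ.IsPrimitive) (α : R) (b : F) :
    ∑ a, (if a = 0 then 1 else α) * ψ (a * b) =
      if b = 0 then 1 + ((Fintype.card F : R) - 1) * α else 1 - α := by
  have h (a : F) : (if a = 0 then 1 else α) * ψ (a * b) =
      α * ψ (a * b) + if a = 0 then 1 - α else 0 := by
    split_ifs with ha
    · simp [ha]
    · simp
  simp_rw [h, sum_add_distrib, ← mul_sum, AddChar.sum_mulShift b hψ]
  split_ifs <;> simp
  ring

theorem sum_pow_wtv_mul_addChar {R : Type*} [CommRing R] [IsDomain R] {ψ : AddChar F R}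
    (hψ : ψ.IsPrimitive) (α : R) (y : Fin n → F) :
    ∑ x : Fin n → F, α ^ wtv x * ψ (∑ i, x i * y i) =
      (1 - α) ^ wtv y * (1 + ((Fintype.card F : R) - 1) * α) ^ (n - wtv y) := by
  rw [← prod_ite_eq_zero_eq_pow_wtv]
  simp_rw [← sum_ite_mul_addChar hψ, Fintype.prod_sum, prod_mul_distrib,
    prod_ite_eq_zero_eq_pow_wtv, one_pow, mul_one, addChar_map_sum]

open Classical in
theorem card_mul_sum_dualCode {R : Type*} [CommRing R] [IsDomain R] {ψ : AddChar F R}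
    (hψ : ψ.IsPrimitive) (C : Submodule F (Fin n → F)) (α : R) :
    (Nat.card C : R) * ∑ x with x ∈ dualCode C, α ^ wtv x =
      ∑ y with y ∈ C, (1 - α) ^ wtv y * (1 + ((Fintype.card F : R) - 1) * α) ^ (n - wtv y) := by
  have hψ1 : ψ ≠ 1 := by simpa using hψ one_ne_zero
  simp_rw [← sum_pow_wtv_mul_addChar hψ]
  rw [sum_comm]
  simp_rw [← mul_sum, sum_addChar_code hψ1, mul_ite, mul_zero]
  rw [← sum_filter, ← sum_mul, mul_comm]

end Characters

theorem stmt16 {F : Type*} [Field F] [Fintype F] [DecidableEq F] {n : ℕ} (hn : 1 ≤ n)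
    (k : ℕ) (hk : Fintype.card F = k)
    (C : Submodule F (Fin n → F)) (α : ℝ) :
    ∑ j ∈ Finset.range (n + 1), (wdist (dualCode C) j : ℝ) * α ^ j =
      (1 / (Nat.card C : ℝ)) * ∑ j ∈ Finset.range (n + 1),
        (wdist C j : ℝ) * (1 - α) ^ j * (1 + ((k : ℝ) - 1) * α) ^ (n - j) := by
  classical
  have hC : (Nat.card C : ℝ) ≠ 0 := Nat.cast_ne_zero.2 Nat.card_pos.ne'
  simp_rw [mul_assoc]
  rw [sum_wdist_mul (dualCode C) (α ^ ·),
    sum_wdist_mul C fun j => (1 - α) ^ j * (1 + ((k : ℝ) - 1) * α) ^ (n - j),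
    one_div, eq_inv_mul_iff_mul_eq₀ hC, ← hk]
  exact_mod_cast card_mul_sum_dualCode
    (AddChar.FiniteField.primitiveChar_to_Complex_isPrimitive F) C (α : ℂ)
end

section
/- Let 0 ≤ λ ≤ 1 and let (a_0,…,a_n) be the weight distribution of C. Then Σ_{i=0}^n a_i · ((k^λ − 1)/(k − 1))^i ≤ 2^{H_λ(C)}; equivalently, log₂ Σ_{i=0}^n a_i · ((k^λ − 1)/(k − 1))^i ≤ H_λ(C). -/
open Finset

/-- `C_S`: the image of the code `C` under the coordinate projection `F^n → F^S`. -/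
def projCode {F : Type*} [Field F] {n : ℕ} (C : Submodule F (Fin n → F))
    (S : Finset (Fin n)) : Submodule F ({i // i ∈ S} → F) :=
  C.map (LinearMap.funLeft F F (Subtype.val : {i // i ∈ S} → Fin n))

/-- `H_λ(C) = log₂(k)·(dim C − Σ_S (1−λ)^{|S|} λ^{n−|S|} dim C_S)`, the conditional
entropy (in bits) of a uniform codeword of `C` given the output of the `k`-ary erasure
channel with erasure probability `λ`. -/
noncomputable def condEntropyEC {F : Type*} [Field F] [Fintype F] {n : ℕ}
    (C : Submodule F (Fin n → F)) (lam : ℝ) : ℝ :=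
  Real.logb 2 (Fintype.card F) *
    ((Module.finrank F C : ℝ) -
      ∑ S : Finset (Fin n),
        (1 - lam) ^ S.card * lam ^ (n - S.card) * (Module.finrank F (projCode C S) : ℝ))

theorem finrank_map_add_finrank_inf_ker {F V W : Type*} [Field F] [AddCommGroup V] [Module F V]
    [FiniteDimensional F V] [AddCommGroup W] [Module F W] (A : Submodule F V) (f : V →ₗ[F] W) :
    Module.finrank F (A.map f) + Module.finrank F (A ⊓ LinearMap.ker f : Submodule F V) =
      Module.finrank F A := by
  have h := LinearMap.finrank_range_add_finrank_ker (f.domRestrict A)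
  rw [LinearMap.range_domRestrict, LinearMap.ker_domRestrict] at h
  rw [← h, ← Submodule.map_comap_subtype, Submodule.finrank_map_subtype_eq]

/-- The subspace of vectors vanishing on the coordinates in `S`. -/
def vanishingOn (F : Type*) [Field F] {n : ℕ} (S : Finset (Fin n)) : Submodule F (Fin n → F) where
  carrier := {x | ∀ i ∈ S, x i = 0}
  add_mem' := by
    intro x y hx hy i hi
    simp [hx i hi, hy i hi]
  zero_mem' := by
    intro i _
    rfl
  smul_mem' := by
    intro c x hx i hi
    simp [hx i hi]

theorem mem_vanishingOn {F : Type*} [Field F] {n : ℕ} {S : Finset (Fin n)} {x : Fin n → F} :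
    x ∈ vanishingOn F S ↔ ∀ i ∈ S, x i = 0 := Iff.rfl

/-- The expected dimension of the subspace of `U` vanishing on a random subset of `s` which
contains each coordinate independently with probability `1 - lam`. -/
noncomputable def expVanishingDim {F : Type*} [Field F] {n : ℕ} (lam : ℝ)
    (U : Submodule F (Fin n → F)) (s : Finset (Fin n)) : ℝ :=
  ∑ S ∈ s.powerset, (1 - lam) ^ S.card * lam ^ (s.card - S.card) *
    (Module.finrank F (U ⊓ vanishingOn F S : Submodule F (Fin n → F)) : ℝ)

open Classical in
/-- The weight enumerator of `U` at `t`, counting only the coordinates in `s`. -/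
noncomputable def partialEnumerator {F : Type*} [Field F] [Fintype F] {n : ℕ} (t : ℝ)
    (U : Submodule F (Fin n → F)) (s : Finset (Fin n)) : ℝ :=
  ∑ x : Fin n → F, if x ∈ U then ∏ i ∈ s, (if x i = 0 then 1 else t) else 0

theorem partialEnumerator_empty {F : Type*} [Field F] [Fintype F] {n : ℕ} (t : ℝ)
    (U : Submodule F (Fin n → F)) :
    partialEnumerator t U ∅ = (Fintype.card F : ℝ) ^ Module.finrank F U := by
  classical
  have h := Module.card_eq_pow_finrank (K := F) (V := U)
  rw [Fintype.card_subtype] at h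
  simp only [partialEnumerator, prod_empty, sum_boole]
  exact_mod_cast h

theorem partialEnumerator_insert {F : Type*} [Field F] [Fintype F] {n : ℕ} (t : ℝ)
    (U : Submodule F (Fin n → F)) {s : Finset (Fin n)} {a : Fin n} (ha : a ∉ s) :
    partialEnumerator t U (insert a s) =
      (1 - t) * partialEnumerator t (U ⊓ vanishingOn F {a}) s + t * partialEnumerator t U s := by
  classical
  simp only [partialEnumerator, mul_sum, ← sum_add_distrib]
  refine sum_congr rfl fun x _ => ?_
  rw [prod_insert ha]
  by_cases hx : x ∈ U <;> by_cases hxa : x a = 0 <;>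
    simp [hx, hxa, Submodule.mem_inf, mem_vanishingOn]
  ring

theorem expVanishingDim_empty {F : Type*} [Field F] {n : ℕ} (lam : ℝ)
    (U : Submodule F (Fin n → F)) : expVanishingDim lam U ∅ = Module.finrank F U := by
  have : vanishingOn F (∅ : Finset (Fin n)) = ⊤ := by
    ext x
    simp [mem_vanishingOn]
  rw [expVanishingDim, powerset_empty, sum_singleton, this, inf_top_eq]
  simp

theorem vanishingOn_insert {F : Type*} [Field F] {n : ℕ} (a : Fin n) (S : Finset (Fin n)) :
    vanishingOn F (insert a S) = vanishingOn F {a} ⊓ vanishingOn F S := by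
  ext x
  simp [mem_vanishingOn]

theorem expVanishingDim_insert {F : Type*} [Field F] {n : ℕ} (lam : ℝ)
    (U : Submodule F (Fin n → F)) {s : Finset (Fin n)} {a : Fin n} (ha : a ∉ s) :
    expVanishingDim lam U (insert a s) =
      (1 - lam) * expVanishingDim lam (U ⊓ vanishingOn F {a}) s +
        lam * expVanishingDim lam U s := by
  rw [expVanishingDim, sum_powerset_insert ha, add_comm]
  simp only [expVanishingDim, mul_sum]
  congr 1
  · refine sum_congr rfl fun S hS => ?_
    have haS : a ∉ S := fun h => ha (mem_powerset.1 hS h)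
    rw [card_insert_of_notMem haS, card_insert_of_notMem ha, vanishingOn_insert, inf_assoc,
      Nat.add_sub_add_right]
    ring
  · refine sum_congr rfl fun S hS => ?_
    have hle := card_le_card (mem_powerset.1 hS)
    rw [card_insert_of_notMem ha, Nat.sub_add_comm hle]
    ring

theorem finrank_inf_vanishingOn_singleton {F : Type*} [Field F] {n : ℕ}
    (A : Submodule F (Fin n → F)) (a : Fin n) :
    Module.finrank F A ≤
      Module.finrank F (A ⊓ vanishingOn F {a} : Submodule F (Fin n → F)) + 1 := by
  have hker : vanishingOn F {a} = LinearMap.ker (LinearMap.proj a : (Fin n → F) →ₗ[F] F) := by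
    ext x
    simp [mem_vanishingOn]
  have h := finrank_map_add_finrank_inf_ker A (LinearMap.proj a : (Fin n → F) →ₗ[F] F)
  have h1 := Submodule.finrank_le (A.map (LinearMap.proj a : (Fin n → F) →ₗ[F] F))
  rw [Module.finrank_self] at h1
  rw [hker]
  omega

theorem expVanishingDim_mono {F : Type*} [Field F] {n : ℕ} {lam : ℝ} (h0 : 0 ≤ lam)
    (h1 : lam ≤ 1) {U V : Submodule F (Fin n → F)} (hUV : U ≤ V) (s : Finset (Fin n)) :
    expVanishingDim lam U s ≤ expVanishingDim lam V s := by
  have : 0 ≤ 1 - lam := by linarith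
  refine sum_le_sum fun S _ => mul_le_mul_of_nonneg_left ?_ (by positivity)
  exact_mod_cast Submodule.finrank_mono (inf_le_inf_right _ hUV)

theorem expVanishingDim_le_add_one {F : Type*} [Field F] {n : ℕ} {lam : ℝ} (h0 : 0 ≤ lam)
    (h1 : lam ≤ 1) (U : Submodule F (Fin n → F)) (a : Fin n) (s : Finset (Fin n)) :
    expVanishingDim lam U s ≤ expVanishingDim lam (U ⊓ vanishingOn F {a}) s + 1 := by
  have : 0 ≤ 1 - lam := by linarith
  have hw := sum_pow_mul_eq_add_pow (1 - lam) lam s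
  rw [sub_add_cancel, one_pow] at hw
  conv_rhs => rw [← hw]
  rw [expVanishingDim, expVanishingDim, ← sum_add_distrib]
  refine sum_le_sum fun S _ => ?_
  rw [← mul_add_one]
  refine mul_le_mul_of_nonneg_left ?_ (by positivity)
  have h := finrank_inf_vanishingOn_singleton (U ⊓ vanishingOn F S) a
  rw [inf_right_comm] at h
  exact_mod_cast h

/-- The graph of `t ↦ t ^ lam` lies above its chord on `[1, k]`. -/
theorem chord_le_rpow {k t lam : ℝ} (hk : 1 < k) (ht1 : 1 ≤ t) (htk : t ≤ k) (h0 : 0 ≤ lam)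
    (h1 : lam ≤ 1) : 1 + (k ^ lam - 1) / (k - 1) * (t - 1) ≤ t ^ lam := by
  have hk' : 0 < k - 1 := by linarith
  have hμ0 : 0 ≤ (t - 1) / (k - 1) := div_nonneg (by linarith) hk'.le
  have hμ1 : 0 ≤ 1 - (t - 1) / (k - 1) := by
    rw [sub_nonneg, div_le_one hk']
    linarith
  have h := (Real.concaveOn_rpow h0 h1).2 (Set.mem_Ici.2 zero_le_one)
    (Set.mem_Ici.2 (by linarith : (0 : ℝ) ≤ k)) hμ1 hμ0 (by ring)
  simp only [smul_eq_mul, Real.one_rpow] at h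
  have hmid : (1 - (t - 1) / (k - 1)) * 1 + (t - 1) / (k - 1) * k = t := by
    field_simp
    ring
  rw [hmid] at h
  calc 1 + (k ^ lam - 1) / (k - 1) * (t - 1)
      = (1 - (t - 1) / (k - 1)) * 1 + (t - 1) / (k - 1) * k ^ lam := by ring
    _ ≤ t ^ lam := h

theorem mixture_le_rpow {k h' h lam : ℝ} (hk : 1 < k) (hle : h' ≤ h) (hle' : h ≤ h' + 1)
    (h0 : 0 ≤ lam) (h1 : lam ≤ 1) :
    (1 - (k ^ lam - 1) / (k - 1)) * k ^ h' + (k ^ lam - 1) / (k - 1) * k ^ h ≤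
      k ^ ((1 - lam) * h' + lam * h) := by
  have hk0 : 0 < k := by linarith
  have hc := chord_le_rpow (t := k ^ (h - h')) hk
    (Real.one_le_rpow hk.le (by linarith))
    (by simpa using Real.rpow_le_rpow_of_exponent_le hk.le (by linarith : h - h' ≤ 1)) h0 h1
  have hp : 0 ≤ k ^ h' := by positivity
  have hmul := mul_le_mul_of_nonneg_left hc hp
  have e1 : k ^ h = k ^ h' * k ^ (h - h') := by
    rw [← Real.rpow_add hk0]
    ring_nf
  have e2 : k ^ ((1 - lam) * h' + lam * h) = k ^ h' * (k ^ (h - h')) ^ lam := by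
    rw [← Real.rpow_mul hk0.le, ← Real.rpow_add hk0]
    ring_nf
  rw [e1, e2]
  linarith

theorem partialEnumerator_le {F : Type*} [Field F] [Fintype F] {n : ℕ} {lam : ℝ} (h0 : 0 ≤ lam)
    (h1 : lam ≤ 1) (s : Finset (Fin n)) (U : Submodule F (Fin n → F)) :
    partialEnumerator (((Fintype.card F : ℝ) ^ lam - 1) / ((Fintype.card F : ℝ) - 1)) U s ≤
      (Fintype.card F : ℝ) ^ expVanishingDim lam U s := by
  have hk : (1 : ℝ) < Fintype.card F := by exact_mod_cast Fintype.one_lt_card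
  induction s using Finset.induction_on generalizing U with
  | empty => rw [partialEnumerator_empty, expVanishingDim_empty, Real.rpow_natCast]
  | insert a s ha ih =>
    rw [partialEnumerator_insert _ _ ha, expVanishingDim_insert _ _ ha]
    have hk' : 0 < (Fintype.card F : ℝ) - 1 := by linarith
    have ht0 : 0 ≤ ((Fintype.card F : ℝ) ^ lam - 1) / ((Fintype.card F : ℝ) - 1) :=
      div_nonneg (sub_nonneg.2 (Real.one_le_rpow hk.le h0)) hk'.le
    have ht1 : ((Fintype.card F : ℝ) ^ lam - 1) / ((Fintype.card F : ℝ) - 1) ≤ 1 := by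
      rw [div_le_one hk']
      simpa using Real.rpow_le_rpow_of_exponent_le hk.le h1
    refine le_trans (add_le_add (mul_le_mul_of_nonneg_left (ih _) (sub_nonneg.2 ht1))
      (mul_le_mul_of_nonneg_left (ih _) ht0)) ?_
    exact mixture_le_rpow hk (expVanishingDim_mono h0 h1 inf_le_left s)
      (expVanishingDim_le_add_one h0 h1 U a s) h0 h1

theorem finrank_projCode_add {F : Type*} [Field F] {n : ℕ} (C : Submodule F (Fin n → F))
    (S : Finset (Fin n)) :
    Module.finrank F (projCode C S) +
      Module.finrank F (C ⊓ vanishingOn F S : Submodule F (Fin n → F)) = Module.finrank F C := by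
  have hker : vanishingOn F S =
      LinearMap.ker (LinearMap.funLeft F F (Subtype.val : {i // i ∈ S} → Fin n)) := by
    ext x
    simp [mem_vanishingOn, funext_iff, LinearMap.funLeft_apply]
  rw [hker]
  exact finrank_map_add_finrank_inf_ker C _

theorem condEntropyEC_eq {F : Type*} [Field F] [Fintype F] {n : ℕ}
    (C : Submodule F (Fin n → F)) (lam : ℝ) :
    condEntropyEC C lam = Real.logb 2 (Fintype.card F) * expVanishingDim lam C univ := by
  have hw := sum_pow_mul_eq_add_pow (1 - lam) lam (univ : Finset (Fin n))
  rw [sub_add_cancel, one_pow, powerset_univ, card_univ, Fintype.card_fin] at hw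
  rw [condEntropyEC, expVanishingDim, powerset_univ, card_univ, Fintype.card_fin]
  congr 1
  rw [sub_eq_iff_eq_add, ← sum_add_distrib]
  calc (Module.finrank F C : ℝ)
      = ∑ S : Finset (Fin n), (1 - lam) ^ S.card * lam ^ (n - S.card) * Module.finrank F C := by
        rw [← sum_mul, hw, one_mul]
    _ = _ := by
        refine sum_congr rfl fun S _ => ?_
        rw [← finrank_projCode_add C S]
        push_cast
        ring

theorem sum_wdist_mul_pow {F : Type*} [Field F] [Fintype F] [DecidableEq F] {n : ℕ}
    (C : Submodule F (Fin n → F)) (t : ℝ) :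
    ∑ i ∈ range (n + 1), (wdist C i : ℝ) * t ^ i = partialEnumerator t C univ := by
  classical
  have hwt : ∀ x ∈ univ.filter (fun x : Fin n → F => x ∈ C), wtv x ∈ range (n + 1) := by
    intro x _
    rw [mem_range, Nat.lt_succ_iff, wtv]
    simpa using card_filter_le (univ : Finset (Fin n)) (fun i => x i ≠ 0)
  have henum : partialEnumerator t C univ =
      ∑ x : Fin n → F, if x ∈ C then t ^ wtv x else 0 := by
    refine sum_congr rfl fun x _ => ?_
    have hterm : ∏ i, (if x i = 0 then 1 else t) = t ^ wtv x := by
      rw [prod_ite, prod_const_one, one_mul, prod_const, wtv]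
    rw [← hterm]
    congr!
  rw [henum, ← sum_filter, ← sum_fiberwise_of_maps_to hwt]
  refine sum_congr rfl fun i _ => ?_
  rw [sum_congr rfl (g := fun _ => t ^ i) fun x hx => by rw [(mem_filter.1 hx).2], sum_const,
    nsmul_eq_mul, filter_filter, wdist, Nat.card_eq_fintype_card, Fintype.card_subtype]

theorem stmt18 {F : Type*} [Field F] [Fintype F] [DecidableEq F] {n : ℕ} (hn : 1 ≤ n)
    (k : ℕ) (hk : Fintype.card F = k)
    (C : Submodule F (Fin n → F)) (lam : ℝ) (hlam0 : 0 ≤ lam) (hlam1 : lam ≤ 1) :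
    ∑ i ∈ Finset.range (n + 1),
        (wdist C i : ℝ) * (((k : ℝ) ^ lam - 1) / ((k : ℝ) - 1)) ^ i ≤
      (2 : ℝ) ^ condEntropyEC C lam := by
  subst hk
  have hpos : (0 : ℝ) < Fintype.card F := by exact_mod_cast Fintype.card_pos
  rw [sum_wdist_mul_pow, condEntropyEC_eq, Real.rpow_mul zero_le_two,
    Real.rpow_logb two_pos (by norm_num) hpos]
  exact partialEnumerator_le hlam0 hlam1 univ C
end
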